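/- Let Q be the real 4×4 matrix with rows (0,0,0,−1), (0,0,−1,0), (0,1,0,0), (1,0,0,0), and let Υ be the real 4×4 matrix with rows (−1/2,−√3/2,0,0), (√3/2,−1/2,0,0), (0,0,−1/2,√3/2), (0,0,−√3/2,−1/2). Then for every s ∈ ℝ, the matrix exp(s·Q) lies in SO(4) (i.e. exp(sQ)ᵀ·exp(sQ) = 1 and det exp(sQ) = 1) and commutes with Υ: exp(s·Q)·Υ = Υ·exp(s·Q). -/

import Mathlib

open Matrix

/-- The skew-symmetric matrix `Q`. -/
def Qmat : Matrix (Fin 4) (Fin 4) ℝ :=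
  !![0, 0, 0, -1;
     0, 0, -1, 0;
     0, 1, 0, 0;
     1, 0, 0, 0]

/-- The matrix `Υ` of the generator of the `ℤ₃`-action. -/
noncomputable def UpsilonMat : Matrix (Fin 4) (Fin 4) ℝ :=
  !![-(1 / 2), -(Real.sqrt 3 / 2), 0, 0;
     Real.sqrt 3 / 2, -(1 / 2), 0, 0;
     0, 0, -(1 / 2), Real.sqrt 3 / 2;
     0, 0, -(Real.sqrt 3 / 2), -(1 / 2)]

theorem expQ_orth (s : ℝ) :
    (NormedSpace.exp (s • Qmat))ᵀ * NormedSpace.exp (s • Qmat) = 1 := by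
  have hT : (s • Qmat)ᵀ = -(s • Qmat) := by
    ext i j
    fin_cases i <;> fin_cases j <;> simp [Qmat]
  rw [← Matrix.exp_transpose, hT,
    ← Matrix.exp_add_of_commute _ _ (Commute.neg_left (Commute.refl (s • Qmat)))]
  simp

theorem Q_comm : Commute Qmat UpsilonMat := by
  show Qmat * UpsilonMat = UpsilonMat * Qmat
  ext i j
  fin_cases i <;> fin_cases j <;> simp [Qmat, UpsilonMat, Matrix.mul_apply, Fin.sum_univ_four]

/-- For every `s ∈ ℝ`, `exp(sQ)` lies in `SO(4)` and commutes with `Υ`. -/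
theorem exp_sQ_SO4_and_commutes (s : ℝ) :
    (NormedSpace.exp (s • Qmat))ᵀ * NormedSpace.exp (s • Qmat) = 1 ∧
    (NormedSpace.exp (s • Qmat)).det = 1 ∧
    NormedSpace.exp (s • Qmat) * UpsilonMat = UpsilonMat * NormedSpace.exp (s • Qmat) := by
  refine ⟨expQ_orth s, ?_, ?_⟩
  · have h := congrArg Matrix.det (expQ_orth (s / 2))
    rw [Matrix.det_mul, Matrix.det_transpose, Matrix.det_one] at h
    have hs : s • Qmat = (s / 2) • Qmat + (s / 2) • Qmat := by
      rw [← add_smul, add_halves]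
    rw [hs, Matrix.exp_add_of_commute _ _ (Commute.refl _), Matrix.det_mul, h]
  · exact ((Q_comm.smul_left s).exp_left).eq
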